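/- Let X ~ N(μ, σ²) with σ > 0 and let Φ be the standard normal CDF. Then E[Φ(X)²] = Φ(μ/√(1+σ²)) − 2·T(μ/√(1+σ²), 1/√(1+2σ²)), where T is Owen's T-function. -/

import Mathlib

open MeasureTheory ProbabilityTheory

noncomputable def stdNormalPDF (x : ℝ) : ℝ := Real.exp (-x ^ 2 / 2) / Real.sqrt (2 * Real.pi)

noncomputable def stdNormalCDF (x : ℝ) : ℝ := ∫ t in Set.Iic x, stdNormalPDF t

noncomputable def owenT (h d : ℝ) : ℝ :=
  (1 / (2 * Real.pi)) * ∫ u in (0 : ℝ)..d, Real.exp (-(h ^ 2 * (1 + u ^ 2)) / 2) / (1 + u ^ 2)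

open Filter Topology
open scoped NNReal MeasureTheory

lemma stdNormalPDF_eq_gaussianPDFReal : stdNormalPDF = gaussianPDFReal 0 1 := by
  ext x
  simp [stdNormalPDF, gaussianPDFReal, div_eq_inv_mul]

lemma stdNormalCDF_eq_cdf : stdNormalCDF = cdf (gaussianReal 0 1) := by
  ext x
  rw [cdf_eq_real, measureReal_def, gaussianReal_apply_eq_integral _ one_ne_zero,
    ENNReal.toReal_ofReal
      (integral_nonneg fun t ↦ gaussianPDFReal_nonneg 0 1 t), stdNormalCDF,
    stdNormalPDF_eq_gaussianPDFReal]

lemma integrable_stdNormalPDF : Integrable stdNormalPDF := by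
  rw [stdNormalPDF_eq_gaussianPDFReal]
  exact integrable_gaussianPDFReal 0 1

lemma continuous_stdNormalPDF : Continuous stdNormalPDF := by
  unfold stdNormalPDF
  fun_prop

lemma stdNormalPDF_nonneg (x : ℝ) : 0 ≤ stdNormalPDF x := by
  unfold stdNormalPDF
  positivity

lemma stdNormalPDF_le_one (x : ℝ) : stdNormalPDF x ≤ 1 := by
  unfold stdNormalPDF
  apply div_le_one_of_le₀ _ (Real.sqrt_nonneg _)
  trans 1
  · exact Real.exp_le_one_iff.2 (by nlinarith [sq_nonneg x])
  · exact Real.one_le_sqrt.2 (by nlinarith [Real.pi_gt_three])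

lemma stdNormalCDF_nonneg (x : ℝ) : 0 ≤ stdNormalCDF x := by
  rw [stdNormalCDF_eq_cdf]
  exact cdf_nonneg _ x

lemma stdNormalCDF_le_one (x : ℝ) : stdNormalCDF x ≤ 1 := by
  rw [stdNormalCDF_eq_cdf]
  exact cdf_le_one _ x

lemma tendsto_stdNormalCDF_atBot : Tendsto stdNormalCDF atBot (𝓝 0) := by
  rw [stdNormalCDF_eq_cdf]
  exact tendsto_cdf_atBot _

lemma stdNormalCDF_sub_stdNormalCDF (a b : ℝ) :
    stdNormalCDF b - stdNormalCDF a = ∫ t in a..b, stdNormalPDF t :=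
  intervalIntegral.integral_Iic_sub_Iic integrable_stdNormalPDF.integrableOn
    integrable_stdNormalPDF.integrableOn

lemma hasDerivAt_stdNormalCDF (x : ℝ) : HasDerivAt stdNormalCDF (stdNormalPDF x) x := by
  have h : stdNormalCDF = fun x ↦ stdNormalCDF 0 + ∫ t in (0 : ℝ)..x, stdNormalPDF t := by
    ext x
    rw [← stdNormalCDF_sub_stdNormalCDF]
    ring
  rw [h]
  exact (intervalIntegral.integral_hasDerivAt_right
    (continuous_stdNormalPDF.intervalIntegrable _ _)
    (continuous_stdNormalPDF.stronglyMeasurableAtFilter _ _)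
    continuous_stdNormalPDF.continuousAt).const_add _

lemma continuous_stdNormalCDF : Continuous stdNormalCDF :=
  continuous_iff_continuousAt.2 fun x ↦ (hasDerivAt_stdNormalCDF x).continuousAt

lemma stdNormalCDF_zero : stdNormalCDF 0 = 1 / 2 := by
  have h_neg : stdNormalCDF 0 = ∫ t in Set.Ioi (0 : ℝ), stdNormalPDF t := by
    have h := integral_comp_neg_Iic (0 : ℝ) stdNormalPDF
    rw [neg_zero] at h
    rw [← h]
    simp [stdNormalCDF, stdNormalPDF]
  have h_add := intervalIntegral.integral_Iic_add_Ioi (b := (0 : ℝ))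
    integrable_stdNormalPDF.integrableOn integrable_stdNormalPDF.integrableOn
  rw [← h_neg, stdNormalPDF_eq_gaussianPDFReal,
    integral_gaussianPDFReal_eq_one 0 one_ne_zero, ← stdNormalPDF_eq_gaussianPDFReal] at h_add
  change stdNormalCDF 0 + stdNormalCDF 0 = 1 at h_add
  linarith

lemma gaussianReal_real_Iic_zero (m : ℝ) {v : ℝ≥0} (hv : v ≠ 0) :
    (gaussianReal (-m) v).real (Set.Iic 0) = stdNormalCDF (m / √v) := by
  have hs : 0 < √(v : ℝ) := Real.sqrt_pos.2 (by positivity)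
  have h_law : gaussianReal (-m) v = (gaussianReal 0 1).map (fun x ↦ √(v : ℝ) * x + -m) := by
    rw [← Function.comp_def (fun x ↦ x + -m) (fun x ↦ √(v : ℝ) * x),
      ← Measure.map_map (by fun_prop) (by fun_prop), gaussianReal_map_const_mul,
      gaussianReal_map_add_const]
    congr 1
    · simp
    · ext
      simp
  rw [h_law, map_measureReal_apply (by fun_prop) measurableSet_Iic, stdNormalCDF_eq_cdf,
    cdf_eq_real]
  congr 1
  ext x
  simp only [Set.mem_preimage, Set.mem_Iic, le_div_iff₀ hs]
  constructor <;> intro h <;> linarith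

lemma integral_stdNormalCDF_gaussianReal (m : ℝ) (v : ℝ≥0) :
    ∫ x, stdNormalCDF x ∂gaussianReal m v = stdNormalCDF (m / √(1 + v)) := by
  have h_conv : gaussianReal (-m) (1 + v) = gaussianReal (-m) v ∗ gaussianReal 0 1 := by
    rw [gaussianReal_conv_gaussianReal, add_zero, add_comm]
  have h := gaussianReal_real_Iic_zero m (v := 1 + v) (by positivity)
  rw [h_conv, Measure.conv, map_measureReal_apply (by fun_prop) measurableSet_Iic,
    measureReal_def, Measure.prod_apply (measurableSet_Iic.preimage (by fun_prop)),
    ← integral_toReal (by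
      exact (measurable_measure_prodMk_left
        (measurableSet_Iic.preimage (by fun_prop))).aemeasurable) (by simp)] at h
  push_cast at h
  rw [← h, ← gaussianReal_map_neg, integral_map (by fun_prop) (by
    exact (measurable_measure_prodMk_left
      (measurableSet_Iic.preimage (by fun_prop))).ennreal_toReal.aestronglyMeasurable)]
  congr 1
  ext x
  rw [stdNormalCDF_eq_cdf, cdf_eq_real, measureReal_def]
  congr 2
  ext z
  simp

lemma stdNormalPDF_mul_gaussianPDFReal (m : ℝ) {v : ℝ≥0} (hv : v ≠ 0) (x : ℝ) :
    stdNormalPDF x * gaussianPDFReal m v x =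
      stdNormalPDF (m / √(1 + v)) / √(1 + v) *
        gaussianPDFReal (m / (1 + v)) (v / (1 + v)) x := by
  have hv' : (0 : ℝ) < v := by positivity
  have h1 : (0 : ℝ) < 1 + v := by positivity
  have h_sqrt : √(1 + v : ℝ) * √(2 * Real.pi * (v / (1 + v))) = √(2 * Real.pi * v) := by
    rw [← Real.sqrt_mul h1.le]
    congr 1
    field_simp
  have h_exp : -x ^ 2 / 2 + -(x - m) ^ 2 / (2 * v) =
      -(m / √(1 + v)) ^ 2 / 2 + -(x - m / (1 + v)) ^ 2 / (2 * (v / (1 + v))) := by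
    rw [div_pow, Real.sq_sqrt h1.le]
    field_simp
    ring
  simp only [stdNormalPDF, gaussianPDFReal, NNReal.coe_div, NNReal.coe_add, NNReal.coe_one]
  rw [← h_sqrt, mul_inv]
  have h_mul := congrArg Real.exp h_exp
  rw [Real.exp_add, Real.exp_add] at h_mul
  linear_combination (√(2 * Real.pi))⁻¹ * (√(1 + v : ℝ))⁻¹ *
    (√(2 * Real.pi * (v / (1 + v))))⁻¹ * h_mul

lemma integral_stdNormalCDF_mul_stdNormalPDF (m : ℝ) {v : ℝ≥0} (hv : v ≠ 0) :
    ∫ x, stdNormalCDF x * stdNormalPDF x ∂gaussianReal m v =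
      stdNormalPDF (m / √(1 + v)) / √(1 + v) *
        stdNormalCDF (m / √(1 + v) * (1 / √(1 + 2 * v))) := by
  have h1 : (0 : ℝ) < 1 + v := by positivity
  have h_arg : m / √(1 + v) * (1 / √(1 + 2 * v)) =
      (m / (1 + v)) / √(1 + ((v / (1 + v) : ℝ≥0) : ℝ)) := by
    have h_sqrt : √(1 + ((v / (1 + v) : ℝ≥0) : ℝ)) = √(1 + 2 * v) / √(1 + v) := by
      rw [← Real.sqrt_div (by positivity)]
      congr 1
      push_cast
      field_simp
      ring
    have hs : √(1 + v : ℝ) ^ 2 = 1 + v := Real.sq_sqrt h1.le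
    have hs' : √(1 + v : ℝ) ≠ 0 := by positivity
    have h2 : √(1 + 2 * v : ℝ) ≠ 0 := by positivity
    rw [h_sqrt]
    field_simp
    rw [hs]
  rw [h_arg, ← integral_stdNormalCDF_gaussianReal, integral_gaussianReal_eq_integral_smul hv,
    integral_gaussianReal_eq_integral_smul (by positivity), ← integral_const_mul]
  congr 1
  ext x
  simp only [smul_eq_mul]
  linear_combination stdNormalCDF x * stdNormalPDF_mul_gaussianPDFReal m hv x

lemma integral_stdNormalCDF_sq_gaussianReal_eq_shift (m : ℝ) (v : ℝ≥0) :
    ∫ x, stdNormalCDF x ^ 2 ∂gaussianReal m v =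
      ∫ x, stdNormalCDF (x + m) ^ 2 ∂gaussianReal 0 v := by
  have h := gaussianReal_map_add_const (μ := 0) (v := v) m
  rw [zero_add] at h
  have hc := continuous_stdNormalCDF
  rw [← h, integral_map (by fun_prop) (Continuous.aestronglyMeasurable (by fun_prop))]

lemma hasDerivAt_integral_stdNormalCDF_sq (m : ℝ) {v : ℝ≥0} (hv : v ≠ 0) :
    HasDerivAt (fun m ↦ ∫ x, stdNormalCDF x ^ 2 ∂gaussianReal m v)
      (2 * (stdNormalPDF (m / √(1 + v)) / √(1 + v) *
        stdNormalCDF (m / √(1 + v) * (1 / √(1 + 2 * v))))) m := by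
  have hc := continuous_stdNormalCDF
  have hp := continuous_stdNormalPDF
  have h_int : ∫ x, 2 * (stdNormalCDF (x + m) * stdNormalPDF (x + m)) ∂gaussianReal 0 v =
      2 * (stdNormalPDF (m / √(1 + v)) / √(1 + v) *
        stdNormalCDF (m / √(1 + v) * (1 / √(1 + 2 * v)))) := by
    have h := gaussianReal_map_add_const (μ := 0) (v := v) m
    rw [zero_add] at h
    rw [← integral_stdNormalCDF_mul_stdNormalPDF m hv, ← h, integral_map (by fun_prop)
      (Continuous.aestronglyMeasurable (by fun_prop)), integral_const_mul]
  rw [← h_int]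
  simp only [integral_stdNormalCDF_sq_gaussianReal_eq_shift]
  refine (hasDerivAt_integral_of_dominated_loc_of_deriv_le (s := Set.univ)
    (F := fun m x ↦ stdNormalCDF (x + m) ^ 2)
    (F' := fun m x ↦ 2 * (stdNormalCDF (x + m) * stdNormalPDF (x + m)))
    (bound := fun _ ↦ 2) univ_mem ?_ ?_ ?_ ?_ (integrable_const _) ?_).2
  · exact Eventually.of_forall fun m ↦ by
      exact Continuous.aestronglyMeasurable (by fun_prop)
  · refine Integrable.of_bound (Continuous.aestronglyMeasurable (by fun_prop)) 1
      (Eventually.of_forall fun x ↦ ?_)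
    rw [Real.norm_of_nonneg (by positivity)]
    exact pow_le_one₀ (stdNormalCDF_nonneg _) (stdNormalCDF_le_one _)
  · exact Continuous.aestronglyMeasurable (by fun_prop)
  · refine Eventually.of_forall fun x m _ ↦ ?_
    have h0 := stdNormalCDF_nonneg (x + m)
    have h0' := stdNormalPDF_nonneg (x + m)
    rw [Real.norm_of_nonneg (by positivity)]
    linarith [mul_le_one₀ (stdNormalCDF_le_one (x + m)) h0' (stdNormalPDF_le_one (x + m))]
  · refine Eventually.of_forall fun x m _ ↦ ?_
    have h := ((hasDerivAt_stdNormalCDF (x + m)).comp_const_add x m).pow 2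
    refine h.congr_deriv ?_
    norm_num
    ring

lemma hasDerivAt_owenT (h d : ℝ) :
    HasDerivAt (fun h ↦ owenT h d)
      (-(stdNormalPDF h * (stdNormalCDF (h * d) - 1 / 2))) h := by
  have h_pos (u : ℝ) : (1 : ℝ) + u ^ 2 ≠ 0 := by positivity
  have h_int : 1 / (2 * Real.pi) *
      ∫ u in (0 : ℝ)..d, -h * Real.exp (-(h ^ 2 * (1 + u ^ 2)) / 2) =
      -(stdNormalPDF h * (stdNormalCDF (h * d) - 1 / 2)) := by
    have h_sub := intervalIntegral.smul_integral_comp_mul_left (a := 0) (b := d) stdNormalPDF h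
    rw [mul_zero, ← stdNormalCDF_sub_stdNormalCDF, stdNormalCDF_zero, smul_eq_mul] at h_sub
    rw [← h_sub, ← intervalIntegral.integral_const_mul, ← intervalIntegral.integral_const_mul,
      ← intervalIntegral.integral_const_mul, ← intervalIntegral.integral_neg]
    congr 1
    ext u
    have h_exp : Real.exp (-(h ^ 2 * (1 + u ^ 2)) / 2) =
        Real.exp (-h ^ 2 / 2) * Real.exp (-(h * u) ^ 2 / 2) := by
      rw [← Real.exp_add]
      congr 1
      ring
    have hs : √(2 * Real.pi) ^ 2 = 2 * Real.pi := Real.sq_sqrt (by positivity)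
    rw [h_exp, ← hs]
    simp only [stdNormalPDF]
    ring
  rw [← h_int]
  refine ((intervalIntegral.hasDerivAt_integral_of_dominated_loc_of_deriv_le
    (s := Metric.ball h 1)
    (F := fun h u ↦ Real.exp (-(h ^ 2 * (1 + u ^ 2)) / 2) / (1 + u ^ 2))
    (F' := fun h u ↦ -h * Real.exp (-(h ^ 2 * (1 + u ^ 2)) / 2))
    (bound := fun _ ↦ |h| + 1) (Metric.ball_mem_nhds _ one_pos) ?_ ?_ ?_ ?_ ?_ ?_).2).const_mul _
  · exact Eventually.of_forall fun h ↦ by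
      exact Continuous.aestronglyMeasurable (by fun_prop (disch := exact h_pos))
  · exact Continuous.intervalIntegrable (by fun_prop (disch := exact h_pos)) _ _
  · exact Continuous.aestronglyMeasurable (by fun_prop)
  · refine Eventually.of_forall fun u _ y hy ↦ ?_
    rw [Metric.mem_ball, Real.dist_eq] at hy
    have hy' : |y| ≤ |h| + 1 := by linarith [abs_sub_abs_le_abs_sub y h]
    have h_exp : Real.exp (-(y ^ 2 * (1 + u ^ 2)) / 2) ≤ 1 :=
      Real.exp_le_one_iff.2 (by have : 0 ≤ y ^ 2 * (1 + u ^ 2) := by positivity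
                                linarith)
    rw [norm_mul, norm_neg, Real.norm_eq_abs, Real.norm_of_nonneg (Real.exp_nonneg _)]
    exact (mul_le_of_le_one_right (abs_nonneg y) h_exp).trans hy'
  · exact intervalIntegrable_const
  · refine Eventually.of_forall fun u _ y _ ↦ ?_
    have h := ((((hasDerivAt_pow 2 y).mul_const (1 + u ^ 2)).neg.div_const 2).exp).div_const
      (1 + u ^ 2)
    refine h.congr_deriv ?_
    have := h_pos u
    norm_num
    field_simp

lemma tendsto_owenT_atBot (d : ℝ) : Tendsto (fun h ↦ owenT h d) atBot (𝓝 0) := by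
  have h_bound (h : ℝ) : |owenT h d| ≤ 1 / (2 * Real.pi) * (Real.exp (-h ^ 2 / 2) * |d|) := by
    rw [owenT, abs_mul, abs_of_nonneg (by positivity : 0 ≤ 1 / (2 * Real.pi))]
    gcongr
    have := intervalIntegral.norm_integral_le_of_norm_le_const (a := 0) (b := d)
      (f := fun u ↦ Real.exp (-(h ^ 2 * (1 + u ^ 2)) / 2) / (1 + u ^ 2))
      (C := Real.exp (-h ^ 2 / 2)) fun u _ ↦ by
        rw [Real.norm_of_nonneg (by positivity)]
        refine (div_le_self (Real.exp_nonneg _) (by nlinarith [sq_nonneg u])).trans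
          (Real.exp_le_exp.2 ?_)
        nlinarith [mul_nonneg (sq_nonneg h) (sq_nonneg u)]
    simpa using this
  have h_sq : Tendsto (fun h : ℝ ↦ -h ^ 2 / 2) atBot atBot := by
    have h_even : Tendsto (fun h : ℝ ↦ h ^ 2) atBot atTop :=
      tendsto_pow_atTop (n := 2) two_ne_zero |>.comp tendsto_abs_atBot_atTop |>.congr
        fun h ↦ by simp
    exact (tendsto_neg_atTop_atBot.comp h_even).atBot_div_const two_pos
  refine squeeze_zero_norm h_bound ?_
  simpa using ((Real.tendsto_exp_atBot.comp h_sq).mul_const |d|).const_mul (1 / (2 * Real.pi))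

lemma tendsto_integral_stdNormalCDF_sq_atBot (v : ℝ≥0) :
    Tendsto (fun m ↦ ∫ x, stdNormalCDF x ^ 2 ∂gaussianReal m v) atBot (𝓝 0) := by
  have hc := continuous_stdNormalCDF
  simp only [integral_stdNormalCDF_sq_gaussianReal_eq_shift]
  suffices h : Tendsto (fun m ↦ ∫ x, stdNormalCDF (x + m) ^ 2 ∂gaussianReal 0 v) atBot
      (𝓝 (∫ _, (0 : ℝ) ∂gaussianReal 0 v)) by rwa [integral_zero] at h
  refine tendsto_integral_filter_of_dominated_convergence (fun _ ↦ 1) ?_ ?_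
    (integrable_const _) ?_
  · exact Eventually.of_forall fun m ↦ Continuous.aestronglyMeasurable (by fun_prop)
  · refine Eventually.of_forall fun m ↦ Eventually.of_forall fun x ↦ ?_
    rw [Real.norm_of_nonneg (by positivity)]
    exact pow_le_one₀ (stdNormalCDF_nonneg _) (stdNormalCDF_le_one _)
  · refine Eventually.of_forall fun x ↦ ?_
    simpa using (tendsto_stdNormalCDF_atBot.comp
      (tendsto_atBot_add_const_left atBot x tendsto_id)).pow 2

theorem integral_stdNormalCDF_sq_gaussianReal (m : ℝ) {v : ℝ≥0} (hv : v ≠ 0) :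
    ∫ x, stdNormalCDF x ^ 2 ∂gaussianReal m v =
      stdNormalCDF (m / √(1 + v)) - 2 * owenT (m / √(1 + v)) (1 / √(1 + 2 * v)) := by
  have hs : 0 < √(1 + v : ℝ) := by positivity
  set D : ℝ → ℝ := fun m ↦ ∫ x, stdNormalCDF x ^ 2 ∂gaussianReal m v -
    (stdNormalCDF (m / √(1 + v)) - 2 * owenT (m / √(1 + v)) (1 / √(1 + 2 * v))) with hD
  have h_deriv (m : ℝ) : HasDerivAt D 0 m := by
    have h_div := (hasDerivAt_id m).div_const √(1 + v : ℝ)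
    have h_cdf := (hasDerivAt_stdNormalCDF (m / √(1 + v))).comp m h_div
    have h_owen := (hasDerivAt_owenT (m / √(1 + v)) (1 / √(1 + 2 * v))).comp m h_div
    refine ((hasDerivAt_integral_stdNormalCDF_sq m hv).sub
      (h_cdf.sub (h_owen.const_mul 2))).congr_deriv ?_
    ring
  have h_lim : Tendsto D atBot (𝓝 0) := by
    have h_div : Tendsto (fun m : ℝ ↦ m / √(1 + v : ℝ)) atBot atBot :=
      tendsto_id.atBot_div_const hs
    simpa [hD] using (tendsto_integral_stdNormalCDF_sq_atBot v).sub
      ((tendsto_stdNormalCDF_atBot.comp h_div).sub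
        (((tendsto_owenT_atBot (1 / √(1 + 2 * v))).comp h_div).const_mul 2))
  have h_const (y : ℝ) : D y = D m :=
    is_const_of_deriv_eq_zero (fun x ↦ (h_deriv x).differentiableAt)
      (fun x ↦ (h_deriv x).deriv) y m
  have h_zero : D m = 0 :=
    tendsto_nhds_unique (tendsto_const_nhds.congr fun y ↦ (h_const y).symm) h_lim
  exact sub_eq_zero.1 h_zero

theorem stmt_6 {Ω : Type*} [MeasurableSpace Ω] (μ : Measure Ω) [IsProbabilityMeasure μ]
    (X : Ω → ℝ) (hX : Measurable X) (m σ : ℝ) (hσ : 0 < σ)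
    (hlaw : Measure.map X μ = gaussianReal m (Real.toNNReal (σ ^ 2))) :
    ∫ ω, (stdNormalCDF (X ω)) ^ 2 ∂μ =
      stdNormalCDF (m / Real.sqrt (1 + σ ^ 2)) -
        2 * owenT (m / Real.sqrt (1 + σ ^ 2)) (1 / Real.sqrt (1 + 2 * σ ^ 2)) := by
  have hv : Real.toNNReal (σ ^ 2) ≠ 0 := (Real.toNNReal_pos.2 (by positivity)).ne'
  rw [← integral_map (f := fun x ↦ stdNormalCDF x ^ 2) hX.aemeasurable
    (continuous_stdNormalCDF.pow 2).aestronglyMeasurable, hlaw,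
    integral_stdNormalCDF_sq_gaussianReal m hv, Real.coe_toNNReal _ (sq_nonneg σ)]
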